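/- Let α ∈ [0,1), γ ∈ ℝ \ {0}, and a ∈ (0,1). Define Φ : ℝ³ → ℝ⁶ on a neighborhood of (−a, 0, −γ(a/(a+1))^{α+1}) by Φ(x₃, y₃, γ₂) := (Re P₁, Im P₁, Re P₂, Im P₂, Re P₃, Im P₃), where z₁ := 1, z₂ := 0, z₃ := x₃ + i y₃, γ₁ := γ, γ₃ := γ a^{α+1}, and P_j := −(Ĉ_α/2) ∑_{k≠j} γ_k (z_j − z_k)/|z_j − z_k|^{α+2} for j = 1,2,3. Then Φ is differentiable at (−a, 0, −γ(a/(a+1))^{α+1}), and its Fréchet derivative there, a linear map ℝ³ → ℝ⁶, is injective and has range of codimension 3 in ℝ⁶ (i.e. rank 3). In particular the stationary tripole is a non-degenerate stationary configuration. -/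

import Mathlib

/-- The constant `Ĉ_α = 2^α Γ(1+α/2)/Γ(1−α/2)` of the gSQG point vortex model. -/
noncomputable def Chat (α : ℝ) : ℝ :=
  2 ^ α * Real.Gamma (1 + α / 2) / Real.Gamma (1 - α / 2)

theorem Chat_pos {α : ℝ} (hα : α ∈ Set.Ico (0 : ℝ) 1) : 0 < Chat α := by
  obtain ⟨h0, h1⟩ := hα
  have hnum : 0 < Real.Gamma (1 + α / 2) := Real.Gamma_pos_of_pos (by linarith)
  have hden : 0 < Real.Gamma (1 - α / 2) := Real.Gamma_pos_of_pos (by linarith)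
  unfold Chat
  positivity

/-- The interaction kernel `w / |w|^p` of the point vortex model. -/
noncomputable def vortexKernel (p : ℝ) (w : ℂ) : ℂ :=
  w / ((‖w‖ ^ p : ℝ) : ℂ)

theorem vortexKernel_eq_smul (p : ℝ) (w : ℂ) :
    vortexKernel p w = (‖w‖ ^ 2) ^ (-p / 2) • w := by
  have h : (‖w‖ ^ 2) ^ (-p / 2) = (‖w‖ ^ p)⁻¹ := by
    rw [← Real.rpow_natCast, ← Real.rpow_mul (norm_nonneg w), ← Real.rpow_neg (norm_nonneg w)]
    congr 1
    push_cast
    ring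
  rw [h, vortexKernel, Complex.real_smul, Complex.ofReal_inv, div_eq_inv_mul]

theorem differentiableAt_vortexKernel (p : ℝ) {w : ℂ} (hw : w ≠ 0) :
    DifferentiableAt ℝ (vortexKernel p) w := by
  rw [funext (vortexKernel_eq_smul p)]
  have h : DifferentiableAt ℝ (fun w : ℂ => ‖w‖ ^ 2) w :=
    (hasStrictFDerivAt_norm_sq w).hasFDerivAt.differentiableAt
  exact (h.rpow_const (Or.inl (by positivity))).smul differentiableAt_id

/-- At a nonzero real point the derivative of the kernel is diagonal in the real and imaginary
directions. -/
theorem fderiv_vortexKernel_ofReal (p : ℝ) {r : ℝ} (hr : r ≠ 0) (h : ℂ) :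
    fderiv ℝ (vortexKernel p) (r : ℂ) h =
      ((r ^ 2) ^ (-p / 2) : ℝ) • (⟨(1 - p) * h.re, h.im⟩ : ℂ) := by
  have hr' : (r : ℂ) ≠ 0 := Complex.ofReal_ne_zero.2 hr
  have hd := (((hasStrictFDerivAt_norm_sq (r : ℂ)).hasFDerivAt.rpow_const (p := -p / 2)
    (Or.inl (by positivity))).smul (hasFDerivAt_id (𝕜 := ℝ) (r : ℂ)))
  have hpow : (r ^ 2) ^ (-p / 2 - 1) * r ^ 2 = (r ^ 2) ^ (-p / 2) := by
    rw [Real.rpow_sub_one (by positivity)]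
    field_simp
  rw [funext (vortexKernel_eq_smul p)]
  erw [hd.fderiv]
  apply Complex.ext
  · simp [Complex.inner]
    rw [← hpow]
    ring
  · simp

theorem finrank_quotient_range_of_injective {K V W : Type*} [Field K] [AddCommGroup V] [Module K V]
    [AddCommGroup W] [Module K W] [FiniteDimensional K W] (f : V →ₗ[K] W)
    (hf : Function.Injective f) :
    Module.finrank K (W ⧸ LinearMap.range f) = Module.finrank K W - Module.finrank K V := by
  rw [Submodule.finrank_quotient, LinearMap.finrank_range_of_inj hf]

/-- Non-degeneracy of the stationary tripole: the map collecting the real and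
imaginary parts of the stationary residuals `P₁, P₂, P₃`, as a function of the
free coordinates `(x₃, y₃, γ₂)`, is differentiable at
`(−a, 0, −γ(a/(a+1))^{α+1})` with injective derivative whose range has
codimension 3 in `ℝ⁶`. -/
theorem tripole_nondegenerate
    (α : ℝ) (hα : α ∈ Set.Ico (0 : ℝ) 1) (γ a : ℝ) (hγ : γ ≠ 0)
    (ha : a ∈ Set.Ioo (0 : ℝ) 1)
    (Φ : (Fin 3 → ℝ) → (Fin 6 → ℝ))
    (hΦ : ∀ v : Fin 3 → ℝ,
      Φ v =
        let z₁ : ℂ := 1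
        let z₂ : ℂ := 0
        let z₃ : ℂ := (v 0 : ℂ) + (v 1 : ℂ) * Complex.I
        let γ₁ : ℝ := γ
        let γ₂ : ℝ := v 2
        let γ₃ : ℝ := γ * a ^ (α + 1)
        let P₁ : ℂ := -((Chat α / 2 : ℝ) : ℂ) *
          ((γ₂ : ℂ) * (z₁ - z₂) / ((‖z₁ - z₂‖ ^ (α + 2) : ℝ) : ℂ) +
           (γ₃ : ℂ) * (z₁ - z₃) / ((‖z₁ - z₃‖ ^ (α + 2) : ℝ) : ℂ))
        let P₂ : ℂ := -((Chat α / 2 : ℝ) : ℂ) *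
          ((γ₁ : ℂ) * (z₂ - z₁) / ((‖z₂ - z₁‖ ^ (α + 2) : ℝ) : ℂ) +
           (γ₃ : ℂ) * (z₂ - z₃) / ((‖z₂ - z₃‖ ^ (α + 2) : ℝ) : ℂ))
        let P₃ : ℂ := -((Chat α / 2 : ℝ) : ℂ) *
          ((γ₁ : ℂ) * (z₃ - z₁) / ((‖z₃ - z₁‖ ^ (α + 2) : ℝ) : ℂ) +
           (γ₂ : ℂ) * (z₃ - z₂) / ((‖z₃ - z₂‖ ^ (α + 2) : ℝ) : ℂ))
        ![P₁.re, P₁.im, P₂.re, P₂.im, P₃.re, P₃.im]) :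
    ∃ Der : (Fin 3 → ℝ) →L[ℝ] (Fin 6 → ℝ),
      HasFDerivAt Φ Der ![-a, 0, -γ * (a / (a + 1)) ^ (α + 1)] ∧
      Function.Injective Der ∧
      Module.finrank ℝ
        ((Fin 6 → ℝ) ⧸ LinearMap.range (Der : (Fin 3 → ℝ) →ₗ[ℝ] (Fin 6 → ℝ))) = 3 := by
  obtain ⟨ha0, -⟩ := ha
  have hC : -(Chat α / 2) ≠ 0 := neg_ne_zero.2 (half_pos (Chat_pos hα)).ne'
  have hγ₃ : γ * a ^ (α + 1) ≠ 0 := mul_ne_zero hγ (Real.rpow_pos_of_pos ha0 _).ne'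
  set c : ℝ := -(Chat α / 2) with hc
  set g : ℝ := γ * a ^ (α + 1)
  set v₀ : Fin 3 → ℝ := ![-a, 0, -γ * (a / (a + 1)) ^ (α + 1)] with hv₀
  let x : (Fin 3 → ℝ) →L[ℝ] ℝ := ContinuousLinearMap.proj 0
  let y : (Fin 3 → ℝ) →L[ℝ] ℝ := ContinuousLinearMap.proj 1
  let s : (Fin 3 → ℝ) →L[ℝ] ℝ := ContinuousLinearMap.proj 2
  let Z : (Fin 3 → ℝ) →L[ℝ] ℂ := Complex.ofRealCLM.comp x + Complex.I • Complex.ofRealCLM.comp y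
  have hZ (v : Fin 3 → ℝ) : Z v = (v 0 : ℂ) + (v 1 : ℂ) * Complex.I := by
    simp [Z, x, y, mul_comm]
  have hZre (v : Fin 3 → ℝ) : (Z v).re = v 0 := by simp [hZ]
  have hZim (v : Fin 3 → ℝ) : (Z v).im = v 1 := by simp [hZ]
  have hZ₀ : Z v₀ = ((-a : ℝ) : ℂ) := by simp [hZ, hv₀]
  let K := vortexKernel (α + 2)
  let P₁ : (Fin 3 → ℝ) → ℂ := fun v => c • (s v • K 1 + g • K (1 - Z v))
  let P₂ : (Fin 3 → ℝ) → ℂ := fun v => c • (γ • K (-1) + g • K (0 - Z v))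
  let P₃ : (Fin 3 → ℝ) → ℂ := fun v => c • (γ • K (Z v - 1) + s v • K (Z v))
  have hΦ' : Φ = fun v =>
      ![(P₁ v).re, (P₁ v).im, (P₂ v).re, (P₂ v).im, (P₃ v).re, (P₃ v).im] := by
    funext v
    rw [hΦ v]
    simp only [P₁, P₂, P₃, K, hZ, vortexKernel, Complex.real_smul, hc, s,
      ContinuousLinearMap.proj_apply, sub_zero, zero_sub, mul_div_assoc, Complex.ofReal_neg]
  have hK {w : ℂ} (hw : w ≠ 0) : DifferentiableAt ℝ K w := differentiableAt_vortexKernel _ hw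
  have hw₁ : (1 - Z v₀ : ℂ) = ((1 + a : ℝ) : ℂ) := by rw [hZ₀]; push_cast; ring
  have hw₂ : (0 - Z v₀ : ℂ) = (a : ℂ) := by rw [hZ₀]; push_cast; ring
  have hw₃ : (Z v₀ - 1 : ℂ) = ((-a - 1 : ℝ) : ℂ) := by rw [hZ₀]; push_cast; ring
  have hd₁ := (((s.hasFDerivAt (x := v₀)).smul_const (K 1)).add
    (((hK (w := 1 - Z v₀) (by rw [hw₁, Complex.ofReal_ne_zero]; linarith)).hasFDerivAt.comp v₀
      (Z.hasFDerivAt.const_sub 1)).const_smul g)).const_smul c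
  have hd₂ := (((hK (w := 0 - Z v₀) (by
      rw [hw₂, Complex.ofReal_ne_zero]; linarith)).hasFDerivAt.comp v₀
      (Z.hasFDerivAt.const_sub 0)).const_smul g |>.const_add (γ • K (-1))).const_smul c
  rw [hw₂] at hd₂
  have hd₃ : DifferentiableAt ℝ P₃ v₀ := by
    have h₁ := (hK (w := Z v₀ - 1) (by rw [hw₃, Complex.ofReal_ne_zero]; linarith)).comp v₀
      (Z.differentiableAt.sub_const 1)
    have h₂ := (hK (w := Z v₀) (by rw [hZ₀, Complex.ofReal_ne_zero]; linarith)).comp v₀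
      Z.differentiableAt
    exact ((h₁.const_smul γ).add (s.differentiableAt.smul h₂)).const_smul c
  have hre {P : (Fin 3 → ℝ) → ℂ} {D} (h : HasFDerivAt P D v₀) :=
    Complex.reCLM.hasFDerivAt.comp v₀ h
  have him {P : (Fin 3 → ℝ) → ℂ} {D} (h : HasFDerivAt P D v₀) :=
    Complex.imCLM.hasFDerivAt.comp v₀ h
  have hΦd : DifferentiableAt ℝ Φ v₀ := by
    rw [hΦ', differentiableAt_pi]
    intro i
    fin_cases i
    exacts [(hre hd₁).differentiableAt, (him hd₁).differentiableAt, (hre hd₂).differentiableAt,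
      (him hd₂).differentiableAt, (hre hd₃.hasFDerivAt).differentiableAt,
      (him hd₃.hasFDerivAt).differentiableAt]
  have hcomp := hasFDerivAt_pi'.1 hΦd.hasFDerivAt
  have e₀ := (hcomp 0).unique (by rw [hΦ']; exact hre hd₁)
  have e₂ := (hcomp 2).unique (by rw [hΦ']; exact hre hd₂)
  have e₃ := (hcomp 3).unique (by rw [hΦ']; exact him hd₂)
  have hinj : Function.Injective (fderiv ℝ Φ v₀) := by
    rw [injective_iff_map_eq_zero]
    intro h hh
    have f₀ := DFunLike.congr_fun e₀ h
    have f₂ := DFunLike.congr_fun e₂ h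
    have f₃ := DFunLike.congr_fun e₃ h
    have hpa : (a ^ 2) ^ ((-2 + -α) / 2) ≠ 0 := (Real.rpow_pos_of_pos (by positivity) _).ne'
    have hα' : 1 - (α + 2) ≠ 0 := by linarith [hα.1]
    simp [hh, K, fderiv_vortexKernel_ofReal (α + 2) ha0.ne', hZre, hZim, hC, hγ₃, hpa, hα'] at f₂ f₃
    have hZh : Z h = 0 := by simp [hZ, f₂, f₃]
    have hsh : s h = 0 := by
      simpa [hh, K, hZh, hC, vortexKernel] using f₀.symm
    ext i
    fin_cases i
    exacts [f₂, f₃, hsh]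
  refine ⟨fderiv ℝ Φ v₀, hΦd.hasFDerivAt, hinj, ?_⟩
  rw [finrank_quotient_range_of_injective _ hinj]
  simp
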